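/- Let n ≥ 4 be an integer and p a prime. The degree of the diagonal matrix diag(p, p², …, p², p³) (with n−2 middle entries equal to p²) equals p·(p^{n−1}−1)·(p^n−1)/(p−1)². -/

import Mathlib

open Matrix

/-- `Λ_n = GL_n(ℤ)` viewed inside the `n × n` rational matrices: the matrices with integer
entries whose determinant is `±1`. -/
def Lambda (n : ℕ) : Set (Matrix (Fin n) (Fin n) ℚ) :=
  {γ | (∀ i j, ∃ z : ℤ, γ i j = (z : ℚ)) ∧ (γ.det = 1 ∨ γ.det = -1)}

/-- The right coset `Λ_n h = {γ * h : γ ∈ Λ_n}`. -/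
def rightCoset (n : ℕ) (h : Matrix (Fin n) (Fin n) ℚ) : Set (Matrix (Fin n) (Fin n) ℚ) :=
  {m | ∃ γ ∈ Lambda n, m = γ * h}

/-- The double coset `Λ_n g Λ_n = {γ₁ * g * γ₂ : γ₁, γ₂ ∈ Λ_n}`. -/
def doubleCoset (n : ℕ) (g : Matrix (Fin n) (Fin n) ℚ) : Set (Matrix (Fin n) (Fin n) ℚ) :=
  {m | ∃ γ₁ ∈ Lambda n, ∃ γ₂ ∈ Lambda n, m = γ₁ * g * γ₂}

/-- The degree of `g`: the number of distinct right cosets `Λ_n h` contained in `Λ_n g Λ_n`. -/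
noncomputable def degree (n : ℕ) (g : Matrix (Fin n) (Fin n) ℚ) : ℕ :=
  Set.ncard {S : Set (Matrix (Fin n) (Fin n) ℚ) | ∃ h ∈ doubleCoset n g, S = rightCoset n h}

/-- The `k`-th determinantal divisor of an `n × n` integer matrix: the gcd of all of its
`k × k` minors (which is `0` when all these minors vanish), a minor being indexed by a pair
of strictly increasing maps `Fin k → Fin n` selecting rows and columns. -/
def detDiv (n k : ℕ) (C : Matrix (Fin n) (Fin n) ℤ) : ℤ :=
  Finset.gcd ((Finset.univ : Finset ((Fin k → Fin n) × (Fin k → Fin n))).filter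
      (fun fg => (∀ a b : Fin k, a < b → fg.1 a < fg.1 b) ∧
        (∀ a b : Fin k, a < b → fg.2 a < fg.2 b)))
    (fun fg => (C.submatrix fg.1 fg.2).det)

/-- `D^(n)(p) = diag(1, p, …, p, p²)` with `n - 2` middle diagonal entries equal to `p`. -/
def Dmat (n p : ℕ) : Matrix (Fin n) (Fin n) ℤ :=
  Matrix.diagonal (fun i => if i.val = 0 then 1 else if i.val = n - 1 then (p : ℤ) ^ 2 else (p : ℤ))

/-- The set `R₀^(n)(p)` of upper-triangular integer matrices whose determinantal divisors are
`d_k = p^(k-1)` for `1 ≤ k ≤ n - 1` and `d_n = p^n`, whose diagonal entries all equal `p`, and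
whose above-diagonal entries lie in `[0, p)`. -/
def R0 (n p : ℕ) : Set (Matrix (Fin n) (Fin n) ℤ) :=
  {C | (∀ i j : Fin n, j < i → C i j = 0) ∧
    (∀ k : ℕ, 1 ≤ k → k ≤ n - 1 → detDiv n k C = (p : ℤ) ^ (k - 1)) ∧
    detDiv n n C = (p : ℤ) ^ n ∧
    (∀ i : Fin n, C i i = (p : ℤ)) ∧
    (∀ i j : Fin n, i < j → 0 ≤ C i j ∧ C i j < (p : ℤ))}

/-- The set `R₁^(n)(p)` of upper-triangular integer matrices whose diagonal entries lie in
`{1, p, p²}` with exactly one entry `1` and exactly one entry `p²`, whose above-diagonal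
entries satisfy `0 ≤ c i j < c j j`, and such that `p ∣ c i i` implies `p ∣ c i j` for `j > i`. -/
def R1 (n p : ℕ) : Set (Matrix (Fin n) (Fin n) ℤ) :=
  {C | (∀ i j : Fin n, j < i → C i j = 0) ∧
    (∀ i : Fin n, C i i = 1 ∨ C i i = (p : ℤ) ∨ C i i = (p : ℤ) ^ 2) ∧
    (∃! i : Fin n, C i i = 1) ∧
    (∃! i : Fin n, C i i = (p : ℤ) ^ 2) ∧
    (∀ i j : Fin n, i < j → 0 ≤ C i j ∧ C i j < C j j) ∧
    (∀ i j : Fin n, i < j → (p : ℤ) ∣ C i i → (p : ℤ) ∣ C i j)}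

/-- Casting an integer matrix to a rational matrix. -/
def toQ (n : ℕ) (C : Matrix (Fin n) (Fin n) ℤ) : Matrix (Fin n) (Fin n) ℚ :=
  C.map (fun z : ℤ => (z : ℚ))

open Module LinearAlgebra.Projectivization

theorem card_submodule_finrank_one (p n : ℕ) [Fact p.Prime] :
    Nat.card {W : Submodule (ZMod p) (Fin n → ZMod p) // finrank (ZMod p) W = 1} =
      ∑ i ∈ Finset.range n, p ^ i := by
  rw [← Nat.card_congr (Projectivization.equivSubmodule (ZMod p) (Fin n → ZMod p)),
    Projectivization.card_of_finrank (ZMod p) _ (n := n) (by simp)]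
  simp

theorem card_submodule_finrank_pred (p n : ℕ) (hn : 1 ≤ n) [Fact p.Prime] :
    Nat.card {W : Submodule (ZMod p) (Fin n → ZMod p) // finrank (ZMod p) W = n - 1} =
      ∑ i ∈ Finset.range n, p ^ i := by
  have e := Projectivization.equivSubmodule (ZMod p) (Dual (ZMod p) (Fin n → ZMod p))
  have hcard := Projectivization.card_of_finrank (ZMod p) (Dual (ZMod p) (Fin n → ZMod p)) (n := n)
    (by simp)
  rw [Nat.card_congr e, Nat.card_zmod] at hcard
  rw [← hcard]
  refine Nat.card_congr (Equiv.subtypeEquiv ((Subspace.orderIsoFiniteDimensional (K := ZMod p)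
    (V := Fin n → ZMod p)).toEquiv.trans OrderDual.ofDual) fun W => ?_)
  have h := Subspace.finrank_add_finrank_dualAnnihilator_eq W
  have h' : finrank (ZMod p) (Fin n → ZMod p) = n := by simp
  change _ ↔ finrank (ZMod p) W.dualAnnihilator = 1
  omega

theorem index_eq_pow_iff_finrank (p n k : ℕ) (hk : k ≤ n) [Fact p.Prime]
    (W : Submodule (ZMod p) (Fin n → ZMod p)) :
    W.toAddSubgroup.index = p ^ k ↔ finrank (ZMod p) W = n - k := by
  have hp : p.Prime := Fact.out
  have h1 := W.toAddSubgroup.card_mul_index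
  have h2 : Nat.card W.toAddSubgroup = p ^ finrank (ZMod p) W := by
    have := Module.natCard_eq_pow_finrank (K := ZMod p) (V := W)
    rwa [Nat.card_zmod] at this
  have h3 : finrank (ZMod p) W ≤ n := by simpa using W.finrank_le
  have h4 : Nat.card (Fin n → ZMod p) = p ^ n := by simp
  rw [h2, h4] at h1
  have h5 : p ^ finrank (ZMod p) W * p ^ (n - finrank (ZMod p) W) = p ^ n := by
    rw [← pow_add]; congr 1; omega
  have h6 : W.toAddSubgroup.index = p ^ (n - finrank (ZMod p) W) :=
    Nat.eq_of_mul_eq_mul_left (pow_pos hp.pos _) (h1.trans h5.symm)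
  rw [h6, Nat.pow_right_inj hp.two_le]
  omega

/-- Reduction modulo `p` on `ℤⁿ`. -/
def redMod (p n : ℕ) : (Fin n → ℤ) →+ (Fin n → ZMod p) :=
  (Int.castAddHom (ZMod p)).compLeft (Fin n)

theorem redMod_surjective (p n : ℕ) : Function.Surjective (redMod p n) := fun y =>
  ⟨fun i => (ZMod.intCast_surjective (y i)).choose,
    funext fun i => (ZMod.intCast_surjective (y i)).choose_spec⟩

theorem exists_nsmul_eq_of_redMod_eq_zero (p n : ℕ) (x : Fin n → ℤ) (hx : redMod p n x = 0) :
    ∃ y, p • y = x := by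
  have h : ∀ i, ∃ c, x i = p * c := fun i =>
    (ZMod.intCast_zmod_eq_zero_iff_dvd (x i) p).1 (congrFun hx i)
  choose y hy using h
  exact ⟨y, funext fun i => by simp [hy i]⟩

/-- Subgroups of `ℤⁿ` of index `k` containing `pℤⁿ` correspond to subspaces of `𝔽_pⁿ` of
index `k`. -/
noncomputable def subgroupEquivSubmodule (p n k : ℕ) [Fact p.Prime] :
    {W : Submodule (ZMod p) (Fin n → ZMod p) // W.toAddSubgroup.index = k} ≃
      {L : AddSubgroup (Fin n → ℤ) // L.index = k ∧ ∀ x, p • x ∈ L} where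
  toFun W := ⟨W.1.toAddSubgroup.comap (redMod p n), by
      rw [AddSubgroup.index_comap_of_surjective _ (redMod_surjective p n), W.2], fun x => by
      have : redMod p n (p • x) = 0 := by
        rw [map_nsmul]
        ext i
        simp
      rw [AddSubgroup.mem_comap, this]
      exact zero_mem _⟩
  invFun L := ⟨AddSubgroup.toZModSubmodule p (L.1.map (redMod p n)), by
      rw [AddSubgroup.toZModSubmodule_toAddSubgroup, AddSubgroup.index_map,
        AddMonoidHom.range_eq_top.2 (redMod_surjective p n), AddSubgroup.index_top, mul_one,
        sup_eq_left.2, L.2.1]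
      intro x hx
      obtain ⟨y, rfl⟩ := exists_nsmul_eq_of_redMod_eq_zero p n x hx
      exact L.2.2 y⟩
  left_inv W := by
    ext x
    simp [AddSubgroup.map_comap_eq_self_of_surjective (redMod_surjective p n)]
  right_inv L := by
    apply Subtype.ext
    simp only [AddSubgroup.toZModSubmodule_toAddSubgroup]
    rw [AddSubgroup.comap_map_eq, sup_eq_left]
    intro x hx
    obtain ⟨y, rfl⟩ := exists_nsmul_eq_of_redMod_eq_zero p n x hx
    exact L.2.2 y

theorem card_index_prime (p n : ℕ) (hn : 1 ≤ n) [Fact p.Prime] :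
    Nat.card {H : AddSubgroup (Fin n → ℤ) // H.index = p} = ∑ i ∈ Finset.range n, p ^ i := by
  rw [← card_submodule_finrank_pred p n hn,
    ← Nat.card_congr (Equiv.subtypeEquivRight fun W => index_eq_pow_iff_finrank p n 1 hn W),
    pow_one, Nat.card_congr (subgroupEquivSubmodule p n p)]
  refine Nat.card_congr (Equiv.subtypeEquivRight fun H => ⟨fun h => ⟨h, fun x => ?_⟩, And.left⟩)
  exact h ▸ H.nsmul_index_mem x

theorem card_index_pow_pred (p n : ℕ) (hn : 1 ≤ n) [Fact p.Prime] :
    Nat.card {L : AddSubgroup (Fin n → ℤ) // L.index = p ^ (n - 1) ∧ ∀ x, p • x ∈ L} =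
      ∑ i ∈ Finset.range n, p ^ i := by
  rw [← Nat.card_congr (subgroupEquivSubmodule p n _), ← card_submodule_finrank_one p n]
  refine Nat.card_congr (Equiv.subtypeEquivRight fun W => ?_)
  rw [index_eq_pow_iff_finrank p n _ (Nat.sub_le _ _), Nat.sub_sub_self hn]

/-- The subgroup of `ℤⁿ` spanned by the rows of an integer matrix. -/
def rowLattice {n : ℕ} (C : Matrix (Fin n) (Fin n) ℤ) : AddSubgroup (Fin n → ℤ) :=
  C.vecMulLinear.toAddMonoidHom.range

theorem mem_rowLattice {n : ℕ} {C : Matrix (Fin n) (Fin n) ℤ} {x : Fin n → ℤ} :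
    x ∈ rowLattice C ↔ ∃ v, v ᵥ* C = x := Iff.rfl

theorem rowLattice_le_iff {n : ℕ} {A C : Matrix (Fin n) (Fin n) ℤ} :
    rowLattice A ≤ rowLattice C ↔ ∃ B, A = B * C := by
  constructor
  · intro h
    have h' : ∀ i, ∃ v, v ᵥ* C = A i := fun i =>
      mem_rowLattice.1 (h (mem_rowLattice.2 ⟨Pi.single i 1, by simp [Matrix.row]⟩))
    choose B hB using h'
    refine ⟨Matrix.of B, ?_⟩
    ext i j
    rw [← hB i]
    rfl
  · rintro ⟨B, rfl⟩ x hx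
    obtain ⟨v, rfl⟩ := mem_rowLattice.1 hx
    exact mem_rowLattice.2 ⟨v ᵥ* B, by rw [Matrix.vecMul_vecMul]⟩

theorem rowLattice_mul_of_isUnit {n : ℕ} (V C : Matrix (Fin n) (Fin n) ℤ) (hV : IsUnit V) :
    rowLattice (V * C) = rowLattice C := by
  obtain ⟨u, rfl⟩ := hV
  refine le_antisymm (rowLattice_le_iff.2 ⟨_, rfl⟩) (rowLattice_le_iff.2 ⟨↑u⁻¹, ?_⟩)
  rw [← mul_assoc, Units.inv_mul, one_mul]

theorem exists_isUnit_of_rowLattice_eq {n : ℕ} {A C : Matrix (Fin n) (Fin n) ℤ}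
    (hC : C.det ≠ 0) (h : rowLattice A = rowLattice C) : ∃ V, IsUnit V ∧ A = V * C := by
  obtain ⟨V, hV⟩ := rowLattice_le_iff.1 h.le
  obtain ⟨W, hW⟩ := rowLattice_le_iff.1 h.ge
  refine ⟨V, ?_, hV⟩
  have hdet : C.det = (W * V).det * C.det := by
    rw [← Matrix.det_mul, mul_assoc, ← hV, ← hW]
  have h1 : W.det * V.det = 1 := by
    rw [← Matrix.det_mul]
    exact mul_right_cancel₀ hC (by rw [one_mul, ← hdet])
  exact (Matrix.isUnit_iff_isUnit_det V).2 (IsUnit.of_mul_eq_one_right _ h1)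

theorem vecMul_injective_of_det_ne_zero {n : ℕ} {C : Matrix (Fin n) (Fin n) ℤ} (hC : C.det ≠ 0) :
    Function.Injective C.vecMulLinear :=
  (injective_iff_map_eq_zero _).2 fun _ hv => Matrix.eq_zero_of_vecMul_eq_zero hC hv

theorem index_rowLattice {n : ℕ} {C : Matrix (Fin n) (Fin n) ℤ} (hC : C.det ≠ 0) :
    (rowLattice C).index = C.det.natAbs := by
  let e : (Fin n → ℤ) ≃ₗ[ℤ] rowLattice C :=
    (AddMonoidHom.ofInjective (f := C.vecMulLinear.toAddMonoidHom)
      (vecMul_injective_of_det_ne_zero hC)).toIntLinearEquiv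
  have he : ∀ v, (e v : Fin n → ℤ) = v ᵥ* C := fun _ => rfl
  let b : Basis (Fin n) ℤ (rowLattice C) := (Pi.basisFun ℤ (Fin n)).map e
  rw [AddSubgroup.index_eq_natAbs_det (Pi.basisFun ℤ (Fin n)) _ b, Pi.basisFun_det]
  congr 2
  ext i j
  have : (b i : Fin n → ℤ) = Pi.single i 1 ᵥ* C := by
    rw [← he, ← Pi.basisFun_apply]
    exact congrArg Subtype.val (Basis.map_apply _ _ _)
  simp [this]

theorem det_diagonal_mul_ne_zero {n : ℕ} {d : Fin n → ℤ} {U : Matrix (Fin n) (Fin n) ℤ}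
    (hd : ∀ i, d i ≠ 0) (hU : IsUnit U) : (Matrix.diagonal d * U).det ≠ 0 := by
  rw [Matrix.det_mul, Matrix.det_diagonal]
  exact mul_ne_zero (Finset.prod_ne_zero_iff.2 fun i _ => hd i)
    ((Matrix.isUnit_iff_isUnit_det U).1 hU).ne_zero

/-- Smith normal form of a subgroup of finite index of `ℤⁿ`. -/
theorem exists_rowLattice_eq {n : ℕ} (L : AddSubgroup (Fin n → ℤ)) (hL : L.index ≠ 0) :
    ∃ (d : Fin n → ℤ) (U : Matrix (Fin n) (Fin n) ℤ), (∀ i, d i ≠ 0) ∧ IsUnit U ∧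
      L = rowLattice (Matrix.diagonal d * U) := by
  obtain ⟨e⟩ := Int.submodule_toAddSubgroup_index_ne_zero_iff (N := L.toIntSubmodule).1 hL
  obtain ⟨b, d, c, hc⟩ := Submodule.exists_smith_normal_form_of_rank_eq
    (Pi.basisFun ℤ (Fin n)) e.finrank_eq
  refine ⟨d, Matrix.of fun i => b i, fun i hi => ?_, ?_, ?_⟩
  · refine c.ne_zero i (Subtype.ext ?_)
    rw [hc, hi, zero_smul]
    rfl
  · rw [Matrix.isUnit_iff_isUnit_det, ← Pi.basisFun_det_apply]
    exact Basis.isUnit_det _ _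
  · ext x
    have h1 : ∀ v : Fin n → ℤ, v ᵥ* (Matrix.diagonal d * Matrix.of fun i => b i) =
        ∑ i, v i • (c i : Fin n → ℤ) := by
      intro v
      ext j
      simp [Matrix.vecMul, dotProduct, hc]
    rw [mem_rowLattice]
    simp only [h1]
    constructor
    · intro hx
      refine ⟨c.repr ⟨x, hx⟩, ?_⟩
      have h2 := congrArg L.toIntSubmodule.subtype (c.sum_repr ⟨x, hx⟩)
      rwa [map_sum] at h2
    · rintro ⟨v, rfl⟩
      exact L.sum_mem fun i _ => L.zsmul_mem (c i).2 _

/-- The subgroup `pℤⁿ` of `ℤⁿ`. -/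
def pLattice (p n : ℕ) : AddSubgroup (Fin n → ℤ) := (nsmulAddMonoidHom p).range

theorem mem_pLattice {p n : ℕ} {x : Fin n → ℤ} : x ∈ pLattice p n ↔ ∃ y, p • y = x := Iff.rfl

theorem pLattice_eq_rowLattice (p n : ℕ) :
    pLattice p n = rowLattice (Matrix.diagonal fun _ => (p : ℤ)) := by
  ext x
  rw [mem_pLattice, mem_rowLattice]
  refine exists_congr fun y => ?_
  have : y ᵥ* Matrix.diagonal (fun _ => (p : ℤ)) = p • y := by
    ext i
    simp [Matrix.vecMul_diagonal, mul_comm]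
  rw [this]

theorem index_pLattice (p n : ℕ) (hp : p ≠ 0) : (pLattice p n).index = p ^ n := by
  have hdet : (Matrix.diagonal fun _ : Fin n => (p : ℤ)).det = (p : ℤ) ^ n := by simp
  rw [pLattice_eq_rowLattice, index_rowLattice, hdet, Int.natAbs_pow, Int.natAbs_natCast]
  rw [hdet]
  exact pow_ne_zero _ (by exact_mod_cast hp)

theorem eq_of_le_of_index_eq {G : Type*} [AddCommGroup G] {A B : AddSubgroup G} (h : A ≤ B)
    (hB : B.index ≠ 0) (hAB : A.index = B.index) : A = B := by
  refine le_antisymm h (AddSubgroup.relIndex_eq_one.1 ?_)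
  have := AddSubgroup.relIndex_mul_index h
  rw [hAB] at this
  exact Nat.eq_of_mul_eq_mul_right (Nat.pos_of_ne_zero hB) (by rw [this, one_mul])

/-- The subgroups of `ℤⁿ` lying between `pH` and `H` and of index `pⁿ` in `ℤⁿ`. -/
def linesIn (p n : ℕ) (H : AddSubgroup (Fin n → ℤ)) : Set (AddSubgroup (Fin n → ℤ)) :=
  {L | (∀ x ∈ H, p • x ∈ L) ∧ L ≤ H ∧ L.index = p ^ n}

/-- The subgroups of `ℤⁿ` of index `pⁿ`, other than `pℤⁿ`, which lie between `pH` and `H` for some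
subgroup `H` of index `p`. -/
def neighborLattices (p n : ℕ) : Set (AddSubgroup (Fin n → ℤ)) :=
  {L | L ≠ pLattice p n ∧ ∃ H : AddSubgroup (Fin n → ℤ), H.index = p ∧ L ∈ linesIn p n H}

theorem pLattice_mem_linesIn (p n : ℕ) (hp : p ≠ 0) (H : AddSubgroup (Fin n → ℤ))
    (hH : H.index = p) : pLattice p n ∈ linesIn p n H := by
  refine ⟨fun x _ => ⟨x, rfl⟩, ?_, index_pLattice p n hp⟩
  rintro _ ⟨y, rfl⟩
  exact hH ▸ H.nsmul_index_mem y

theorem card_linesIn (p n : ℕ) (hn : 1 ≤ n) [Fact p.Prime] (H : AddSubgroup (Fin n → ℤ))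
    (hH : H.index = p) : Nat.card (linesIn p n H) = ∑ i ∈ Finset.range n, p ^ i := by
  have hp : p.Prime := Fact.out
  obtain ⟨d, U, hd, hU, rfl⟩ := exists_rowLattice_eq H (hH ▸ hp.ne_zero)
  set C := Matrix.diagonal d * U
  have hC : C.det ≠ 0 := det_diagonal_mul_ne_zero hd hU
  let f : (Fin n → ℤ) →+ (Fin n → ℤ) := C.vecMulLinear.toAddMonoidHom
  have hf : Function.Injective f := vecMul_injective_of_det_ne_zero hC
  have hrange : f.range = rowLattice C := rfl
  have hpow : p ^ (n - 1) * p = p ^ n := by rw [← pow_succ, Nat.sub_add_cancel hn]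
  have hmap : ∀ L : AddSubgroup (Fin n → ℤ), (L.index = p ^ (n - 1) ∧ ∀ x, p • x ∈ L) →
      L.map f ∈ linesIn p n (rowLattice C) := by
    refine fun L hL => ⟨?_, AddSubgroup.map_le_range f L, ?_⟩
    · rintro _ ⟨y, rfl⟩
      exact ⟨p • y, hL.2 y, map_nsmul f p y⟩
    · rw [AddSubgroup.index_map_of_injective _ hf, hL.1, hrange, hH, hpow]
  have hmap_comap : ∀ L ∈ linesIn p n (rowLattice C), (L.comap f).map f = L := by
    intro L hL
    rw [AddSubgroup.map_comap_eq, inf_eq_right.2]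
    exact hL.2.1
  have hcomap : ∀ L ∈ linesIn p n (rowLattice C),
      (L.comap f).index = p ^ (n - 1) ∧ ∀ x, p • x ∈ L.comap f := by
    refine fun L hL => ⟨Nat.eq_of_mul_eq_mul_right hp.pos ?_, fun x => ?_⟩
    · conv_lhs => rw [← hH, ← hrange, ← AddSubgroup.index_map_of_injective _ hf, hmap_comap L hL]
      rw [hpow, hL.2.2]
    · rw [AddSubgroup.mem_comap, map_nsmul]
      exact hL.1 _ ⟨x, rfl⟩
  rw [← card_index_pow_pred p n hn]
  exact (Nat.card_congr
    { toFun := fun L => ⟨L.1.map f, hmap L.1 L.2⟩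
      invFun := fun L => ⟨L.1.comap f, hcomap L.1 L.2⟩
      left_inv := fun L => Subtype.ext (AddSubgroup.comap_map_eq_self_of_injective hf _)
      right_inv := fun L => Subtype.ext (hmap_comap L.1 L.2) }).symm

theorem eq_of_mem_linesIn (p n : ℕ) [Fact p.Prime] {H H' L : AddSubgroup (Fin n → ℤ)}
    (hH : H.index = p) (hH' : H'.index = p) (hL : L ∈ linesIn p n H) (hL' : L ∈ linesIn p n H')
    (hne : L ≠ pLattice p n) : H = H' := by
  have hp : p.Prime := Fact.out
  by_contra h
  have hsup : H ⊔ H' = ⊤ := by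
    have hdvd := AddSubgroup.index_dvd_of_le (le_sup_left : H ≤ H ⊔ H')
    rw [hH, Nat.dvd_prime hp] at hdvd
    rcases hdvd with h1 | h1
    · exact AddSubgroup.index_eq_one.1 h1
    · have e1 := eq_of_le_of_index_eq (le_sup_left : H ≤ H ⊔ H') (h1 ▸ hp.ne_zero)
        (hH.trans h1.symm)
      have e2 := eq_of_le_of_index_eq (le_sup_right : H' ≤ H ⊔ H') (h1 ▸ hp.ne_zero)
        (hH'.trans h1.symm)
      exact absurd (e1.trans e2.symm) h
  refine hne (eq_of_le_of_index_eq ?_ ?_ ?_).symm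
  · rintro _ ⟨y, rfl⟩
    obtain ⟨a, ha, b, hb, rfl⟩ := AddSubgroup.mem_sup.1 (hsup ▸ AddSubgroup.mem_top y : y ∈ H ⊔ H')
    rw [map_add]
    exact L.add_mem (hL.1 a ha) (hL'.1 b hb)
  · rw [hL.2.2]
    exact pow_ne_zero _ hp.ne_zero
  · rw [index_pLattice p n hp.ne_zero, hL.2.2]

theorem card_neighborLattices (p n : ℕ) (hn : 1 ≤ n) [Fact p.Prime] :
    (neighborLattices p n).ncard =
      (∑ i ∈ Finset.range n, p ^ i) * (∑ i ∈ Finset.range n, p ^ i - 1) := by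
  have hp : p.Prime := Fact.out
  have hpos : 0 < ∑ i ∈ Finset.range n, p ^ i :=
    Finset.sum_pos (fun i _ => pow_pos hp.pos i) ⟨0, Finset.mem_range.2 hn⟩
  have e : (Σ H : {H : AddSubgroup (Fin n → ℤ) // H.index = p},
      ↥(linesIn p n H.1 \ {pLattice p n})) ≃ neighborLattices p n :=
    Equiv.ofBijective (fun x => ⟨x.2.1, x.2.2.2, x.1.1, x.1.2, x.2.2.1⟩) (by
      constructor
      · rintro ⟨⟨H, hH⟩, L, hL⟩ ⟨⟨H', hH'⟩, L', hL'⟩ h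
        obtain rfl : L = L' := congrArg Subtype.val h
        obtain rfl := eq_of_mem_linesIn p n hH hH' hL.1 hL'.1 hL.2
        rfl
      · rintro ⟨L, hL, H, hH, hLH⟩
        exact ⟨⟨⟨H, hH⟩, L, hLH, hL⟩, rfl⟩)
  have : Finite {H : AddSubgroup (Fin n → ℤ) // H.index = p} :=
    Nat.finite_of_card_ne_zero (by rw [card_index_prime p n hn]; exact hpos.ne')
  have := Fintype.ofFinite {H : AddSubgroup (Fin n → ℤ) // H.index = p}
  have hfin : ∀ H : {H : AddSubgroup (Fin n → ℤ) // H.index = p}, (linesIn p n H.1).Finite :=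
    fun H => Set.finite_of_ncard_ne_zero (by
      rw [← Nat.card_coe_set_eq, card_linesIn p n hn H.1 H.2]; exact hpos.ne')
  have : ∀ H : {H : AddSubgroup (Fin n → ℤ) // H.index = p},
      Finite ↥(linesIn p n H.1 \ {pLattice p n}) := fun H => ((hfin H).sdiff).to_subtype
  rw [← Nat.card_coe_set_eq, ← Nat.card_congr e, Nat.card_sigma]
  have hcard : ∀ H : {H : AddSubgroup (Fin n → ℤ) // H.index = p},
      Nat.card ↥(linesIn p n H.1 \ {pLattice p n}) = ∑ i ∈ Finset.range n, p ^ i - 1 := by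
    intro H
    rw [Nat.card_coe_set_eq,
      Set.ncard_sdiff_singleton_of_mem (pLattice_mem_linesIn p n hp.ne_zero H.1 H.2),
      ← Nat.card_coe_set_eq, card_linesIn p n hn H.1 H.2]
  simp only [hcard, Finset.sum_const, Finset.card_univ, smul_eq_mul]
  rw [← Nat.card_eq_fintype_card, card_index_prime p n hn]

theorem vecMul_mem_rowLattice_iff {n : ℕ} {d : Fin n → ℤ} {U : Matrix (Fin n) (Fin n) ℤ}
    (hU : IsUnit U) (c : Fin n → ℤ) :
    c ᵥ* U ∈ rowLattice (Matrix.diagonal d * U) ↔ ∀ i, d i ∣ c i := by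
  rw [mem_rowLattice]
  constructor
  · rintro ⟨v, hv⟩ i
    rw [← Matrix.vecMul_vecMul] at hv
    have h := congrFun (Matrix.vecMul_injective_of_isUnit hU hv) i
    rw [Matrix.vecMul_diagonal] at h
    exact ⟨v i, by rw [← h, mul_comm]⟩
  · intro h
    choose v hv using h
    refine ⟨v, ?_⟩
    rw [← Matrix.vecMul_vecMul]
    congr 1
    ext i
    rw [Matrix.vecMul_diagonal, hv, mul_comm]

theorem rowLattice_submatrix {n : ℕ} (σ : Equiv.Perm (Fin n)) (X : Matrix (Fin n) (Fin n) ℤ) :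
    rowLattice (X.submatrix σ id) = rowLattice X := by
  have hX : X.submatrix σ id = (1 : Matrix (Fin n) (Fin n) ℤ).submatrix σ id * X := by
    ext i j
    simp [Matrix.mul_apply, Matrix.one_apply]
  rw [hX]
  refine rowLattice_mul_of_isUnit _ _ ((Matrix.isUnit_iff_isUnit_det _).2 ?_)
  rw [Matrix.det_permute, Matrix.det_one, mul_one]
  exact (Equiv.Perm.sign σ).isUnit

theorem isUnit_submatrix {n : ℕ} (σ : Equiv.Perm (Fin n)) {U : Matrix (Fin n) (Fin n) ℤ}
    (hU : IsUnit U) : IsUnit (U.submatrix σ id) := by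
  rw [Matrix.isUnit_iff_isUnit_det] at hU ⊢
  rw [Matrix.det_permute]
  exact (Equiv.Perm.sign σ).isUnit.mul hU

/-- A family of exponents at most `2` and with average `1`, not all equal to `1` and taking
the value `2` at most once, takes each of the values `0` and `2` exactly once. -/
theorem exists_zero_and_two {ι : Type*} [Fintype ι] [DecidableEq ι] (k : ι → ℕ)
    (hsum : ∑ i, k i = Fintype.card ι) (hle : ∀ i, k i ≤ 2)
    (huniq : ∀ i j, k i = 2 → k j = 2 → i = j) (hne : ∃ i, k i ≠ 1) :
    ∃ i₀ j₀, k i₀ = 0 ∧ k j₀ = 2 ∧ ∀ i, i ≠ i₀ → i ≠ j₀ → k i = 1 := by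
  have hf : ∑ i, (1 - (k i : ℤ)) = 0 := by
    rw [Finset.sum_sub_distrib, ← Nat.cast_sum, hsum]
    simp
  have htwo : ∃ j₀, k j₀ = 2 := by
    by_contra! h
    have h0 := (Finset.sum_eq_zero_iff_of_nonneg fun i _ => by
      have := hle i; have := h i; omega).1 hf
    obtain ⟨i, hi⟩ := hne
    have := h0 i (Finset.mem_univ i)
    omega
  obtain ⟨j₀, hj₀⟩ := htwo
  have hle' : ∀ i, i ≠ j₀ → k i ≤ 1 := fun i hi => by
    have h1 := hle i
    have h2 : k i ≠ 2 := fun h => hi (huniq i j₀ h hj₀)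
    omega
  rw [← Finset.add_sum_erase _ _ (Finset.mem_univ j₀), hj₀] at hf
  obtain ⟨i₀, hi₀, hki₀⟩ := Finset.exists_ne_zero_of_sum_ne_zero
    (s := Finset.univ.erase j₀) (f := fun i => 1 - (k i : ℤ)) (by intro h; simp [h] at hf)
  have h1 := hle' i₀ (Finset.ne_of_mem_erase hi₀)
  have hz : k i₀ = 0 := by omega
  rw [← Finset.add_sum_erase _ _ hi₀, hz] at hf
  have h0 := (Finset.sum_eq_zero_iff_of_nonneg (s := (Finset.univ.erase j₀).erase i₀)
    (f := fun i => 1 - (k i : ℤ)) fun i hi => by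
      have := hle' i (Finset.ne_of_mem_erase (Finset.mem_of_mem_erase hi))
      omega).1 (by push_cast at hf; linarith)
  refine ⟨i₀, j₀, hz, hj₀, fun i hi hi' => ?_⟩
  have := h0 i (by simp [hi, hi'])
  omega

theorem exists_perm_map_pair {α : Type*} [DecidableEq α] {a b x y : α} (hab : a ≠ b)
    (hxy : x ≠ y) : ∃ σ : Equiv.Perm α, σ a = x ∧ σ b = y := by
  refine ⟨(Equiv.swap a x).trans (Equiv.swap (Equiv.swap a x b) y), ?_, ?_⟩
  · rw [Equiv.trans_apply, Equiv.swap_apply_left]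
    refine Equiv.swap_apply_of_ne_of_ne (fun h => hab ?_) hxy
    exact (Equiv.swap a x).injective ((Equiv.swap_apply_left a x).trans h)
  · rw [Equiv.trans_apply, Equiv.swap_apply_left]

theorem prod_ite_val_eq {n m : ℕ} (hm : m < n) (a : ℤ) :
    ∏ i : Fin n, (if i.val = m then a else 1) = a := by
  rw [Finset.prod_eq_single ⟨m, hm⟩]
  · simp
  · intro i _ hi
    exact if_neg fun h => hi (Fin.ext h)
  · intro h
    exact absurd (Finset.mem_univ _) h

theorem diagonal_mul_Dmat (n p : ℕ) (hn : 2 ≤ n) :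
    Matrix.diagonal (fun i : Fin n => if i.val = 0 then (p : ℤ) else 1) * Dmat n p =
      (p : ℤ) • Matrix.diagonal (fun i : Fin n => if i.val = n - 1 then (p : ℤ) else 1) := by
  rw [Dmat, Matrix.diagonal_mul_diagonal, ← Matrix.diagonal_smul]
  congr 1
  ext i
  simp only [Pi.smul_apply, smul_eq_mul]
  split_ifs <;> first | omega | ring

theorem Dmat_eq_mul (n p : ℕ) (hn : 2 ≤ n) :
    Dmat n p = Matrix.diagonal (fun i : Fin n => if i.val = 0 then 1 else (p : ℤ)) *
      Matrix.diagonal (fun i : Fin n => if i.val = n - 1 then (p : ℤ) else 1) := by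
  rw [Dmat, Matrix.diagonal_mul_diagonal]
  congr 1
  ext i
  split_ifs <;> first | omega | ring

theorem det_Dmat (n p : ℕ) (hn : 2 ≤ n) (hp : p ≠ 0) : (Dmat n p).det = (p : ℤ) ^ n := by
  have hp' : (p : ℤ) ≠ 0 := by exact_mod_cast hp
  have h := congrArg Matrix.det (diagonal_mul_Dmat n p hn)
  rw [Matrix.det_mul, Matrix.det_smul, Matrix.det_diagonal, Matrix.det_diagonal,
    prod_ite_val_eq (by omega), prod_ite_val_eq (by omega), Fintype.card_fin, mul_comm] at h
  exact mul_right_cancel₀ hp' h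

theorem det_Dmat_mul_ne_zero {n p : ℕ} (hn : 2 ≤ n) (hp : p ≠ 0) {U : Matrix (Fin n) (Fin n) ℤ}
    (hU : IsUnit U) : (Dmat n p * U).det ≠ 0 := by
  rw [Matrix.det_mul, det_Dmat n p hn hp]
  exact mul_ne_zero (pow_ne_zero _ (by exact_mod_cast hp))
    ((Matrix.isUnit_iff_isUnit_det U).1 hU).ne_zero

theorem natAbs_det_mul_of_isUnit {n : ℕ} (X : Matrix (Fin n) (Fin n) ℤ)
    {U : Matrix (Fin n) (Fin n) ℤ} (hU : IsUnit U) :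
    (X * U).det.natAbs = X.det.natAbs := by
  rw [Matrix.det_mul, Int.natAbs_mul,
    Int.isUnit_iff_natAbs_eq.1 ((Matrix.isUnit_iff_isUnit_det U).1 hU), mul_one]

theorem natAbs_prod {ι : Type*} (s : Finset ι) (f : ι → ℤ) :
    (∏ i ∈ s, f i).natAbs = ∏ i ∈ s, (f i).natAbs :=
  map_prod Int.natAbsHom f s

theorem rowLattice_Dmat_mul_mem {n p : ℕ} (hn : 2 ≤ n) (hp : p.Prime)
    {U : Matrix (Fin n) (Fin n) ℤ} (hU : IsUnit U) :
    rowLattice (Dmat n p * U) ∈ neighborLattices p n := by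
  set E := Matrix.diagonal (fun i : Fin n => if i.val = n - 1 then (p : ℤ) else 1) with hE
  have hEdet : E.det = p := by rw [hE, Matrix.det_diagonal, prod_ite_val_eq (by omega)]
  refine ⟨fun h => ?_, rowLattice (E * U), ?_, ?_, ?_, ?_⟩
  · rw [pLattice_eq_rowLattice] at h
    obtain ⟨B, hB⟩ := rowLattice_le_iff.1 h.le
    obtain ⟨u, rfl⟩ := hU
    have h1 : Dmat n p = (p : ℤ) • (B * (↑u⁻¹ : Matrix (Fin n) (Fin n) ℤ)) := by
      rw [← Matrix.smul_mul, ← mul_one (Dmat n p), ← Units.mul_inv u, ← mul_assoc, hB,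
        ← Matrix.smul_one_eq_diagonal, Matrix.mul_smul, mul_one]
    have h2 := congrFun (congrFun h1 ⟨0, by omega⟩) ⟨0, by omega⟩
    simp only [Dmat, Matrix.diagonal_apply_eq, if_true, Matrix.smul_apply, smul_eq_mul] at h2
    exact (Nat.prime_iff_prime_int.1 hp).not_isUnit (IsUnit.of_mul_eq_one _ h2.symm)
  · rw [index_rowLattice, natAbs_det_mul_of_isUnit _ hU, hEdet, Int.natAbs_natCast]
    rw [Matrix.det_mul, hEdet]
    exact mul_ne_zero (by exact_mod_cast hp.ne_zero)
      ((Matrix.isUnit_iff_isUnit_det U).1 hU).ne_zero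
  · intro x hx
    obtain ⟨v, rfl⟩ := mem_rowLattice.1 hx
    refine mem_rowLattice.2
      ⟨v ᵥ* Matrix.diagonal (fun i : Fin n => if i.val = 0 then (p : ℤ) else 1), ?_⟩
    rw [Matrix.vecMul_vecMul, ← mul_assoc, diagonal_mul_Dmat n p hn, Matrix.smul_mul,
      Matrix.vecMul_smul, natCast_zsmul]
  · rw [Dmat_eq_mul n p hn, mul_assoc]
    exact rowLattice_le_iff.2 ⟨_, rfl⟩
  · rw [index_rowLattice (det_Dmat_mul_ne_zero hn hp.ne_zero hU), natAbs_det_mul_of_isUnit _ hU,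
      det_Dmat n p hn hp.ne_zero, Int.natAbs_pow, Int.natAbs_natCast]

theorem exists_eq_rowLattice_Dmat_mul {n p : ℕ} (hn : 2 ≤ n) (hp : p.Prime)
    {L : AddSubgroup (Fin n → ℤ)} (hL : L ∈ neighborLattices p n) :
    ∃ U, IsUnit U ∧ L = rowLattice (Dmat n p * U) := by
  obtain ⟨hne, H, hH, hpH, hLH, hidx⟩ := hL
  have : Fact p.Prime := ⟨hp⟩
  obtain ⟨d, U, hd, hU, rfl⟩ := exists_rowLattice_eq L (hidx ▸ pow_ne_zero _ hp.ne_zero)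
  have hmem := vecMul_mem_rowLattice_iff (d := d) hU
  have hpmem : ∀ x, p • x ∈ H := fun x => hH ▸ H.nsmul_index_mem x
  have hpH' : ∀ c : Fin n → ℤ, c ᵥ* U ∈ H → ∀ i, d i ∣ p * c i := fun c hc => by
    have h := hpH _ hc
    rw [← Matrix.smul_vecMul, hmem] at h
    simpa using h
  have hk : ∀ i, ∃ k ≤ 2, (d i).natAbs = p ^ k := fun i => by
    have h := hpH' (p • Pi.single i 1) (by rw [Matrix.smul_vecMul]; exact hpmem _) i
    have h' : (d i).natAbs ∣ p ^ 2 := by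
      have := Int.natAbs_dvd_natAbs.2 h
      simpa [Int.natAbs_mul, sq] using this
    exact (Nat.dvd_prime_pow hp).1 h'
  choose k hk2 hk using hk
  have hsum := hidx
  rw [index_rowLattice (det_diagonal_mul_ne_zero hd hU), natAbs_det_mul_of_isUnit _ hU,
    Matrix.det_diagonal, natAbs_prod, Finset.prod_congr rfl fun i _ => hk i,
    Finset.prod_pow_eq_pow_sum, Nat.pow_right_inj hp.two_le] at hsum
  have huniq : ∀ i j, k i = 2 → k j = 2 → i = j := by
    intro i j hi hj
    by_contra hij
    have hsq : ∀ l, k l = 2 → ∀ c : ℤ, d l ∣ p * c → (p : ℤ) ∣ c := by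
      intro l hl c hc
      have h1 : ((p : ℤ) ^ 2) ∣ p * c := by
        rw [← Int.natAbs_dvd, hk l, hl] at hc
        exact_mod_cast hc
      rw [sq] at h1
      exact Int.dvd_of_mul_dvd_mul_left (by exact_mod_cast hp.ne_zero) h1
    have hnot : ¬ (p : ℤ) ∣ 1 := fun h =>
      (Nat.prime_iff_prime_int.1 hp).not_isUnit (isUnit_of_dvd_one h)
    have hj' : ((Pi.single j 1 : Fin n → ℤ) ᵥ* U : (Fin n → ℤ) ⧸ H) ≠ 0 := by
      intro h
      rw [QuotientAddGroup.eq_zero_iff] at h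
      exact hnot (by simpa using hsq j hj _ (hpH' _ h j))
    obtain ⟨t, ht⟩ := AddSubgroup.mem_zmultiples_iff.1
      (mem_zmultiples_of_prime_card (p := p) (G := (Fin n → ℤ) ⧸ H) hH
        (g' := ((Pi.single i 1 : Fin n → ℤ) ᵥ* U : (Fin n → ℤ) ⧸ H)) hj')
    have hcomb : (-(t • Pi.single j 1) + Pi.single i 1 : Fin n → ℤ) ᵥ* U ∈ H := by
      rw [Matrix.add_vecMul, Matrix.neg_vecMul, Matrix.smul_vecMul]
      exact QuotientAddGroup.eq.1 ht
    have := hsq i hi _ (hpH' _ hcomb i)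
    simp [hij] at this
    exact hnot this
  have hone : ∃ i, k i ≠ 1 := by
    by_contra! h
    choose e he using fun i => Int.natCast_dvd.2 (by rw [hk i, h i, pow_one] : p ∣ (d i).natAbs)
    refine hne (eq_of_le_of_index_eq ?_ ?_ ?_)
    · rw [pLattice_eq_rowLattice]
      refine rowLattice_le_iff.2 ⟨Matrix.diagonal e * U, ?_⟩
      ext i j
      rw [Matrix.mul_diagonal, Matrix.diagonal_mul, Matrix.diagonal_mul, he]
      ring
    · rw [index_pLattice p n hp.ne_zero]
      exact pow_ne_zero _ hp.ne_zero
    · rw [index_pLattice p n hp.ne_zero, hidx]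
  obtain ⟨i₀, j₀, hi₀, hj₀, hrest⟩ := exists_zero_and_two k (by simpa using hsum) hk2 huniq hone
  obtain ⟨σ, hσ₀, hσ₁⟩ := exists_perm_map_pair (a := i₀) (b := j₀)
    (x := (⟨0, by omega⟩ : Fin n)) (y := ⟨n - 1, by omega⟩) (by rintro rfl; omega)
    (by simp; omega)
  let D : Fin n → ℤ :=
    fun i => if i.val = 0 then 1 else if i.val = n - 1 then (p : ℤ) ^ 2 else (p : ℤ)
  have hD : ∀ i, D (σ i) = (p : ℤ) ^ k i := by
    intro i
    by_cases h0 : i = i₀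
    · subst h0
      simp [D, hσ₀, hi₀]
    · by_cases h1 : i = j₀
      · subst h1
        simp only [D, hσ₁, hj₀]
        rw [if_neg (by omega), if_pos trivial]
      · have h2 : (σ i).val ≠ 0 := fun h => h0 (σ.injective (by rw [hσ₀]; exact Fin.ext h))
        have h3 : (σ i).val ≠ n - 1 := fun h => h1 (σ.injective (by rw [hσ₁]; exact Fin.ext h))
        simp [D, h2, h3, hrest i h0 h1]
  have hsign : Matrix.diagonal d =
      Matrix.diagonal (fun i => (d i).sign) * Matrix.diagonal (D ∘ σ) := by
    rw [Matrix.diagonal_mul_diagonal]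
    congr 1
    ext i
    rw [Function.comp_apply, hD, ← Nat.cast_pow, ← hk i, Int.sign_mul_natAbs]
  have hsub : Matrix.diagonal (D ∘ σ) * U =
      (Dmat n p * U.submatrix σ.symm id).submatrix σ id := by
    ext i j
    simp [Dmat, D, Matrix.diagonal_mul]
  refine ⟨U.submatrix σ.symm id, isUnit_submatrix _ hU, ?_⟩
  rw [hsign, mul_assoc, rowLattice_mul_of_isUnit, hsub, rowLattice_submatrix]
  rw [Matrix.isUnit_iff_isUnit_det, Matrix.det_diagonal,
    Int.isUnit_iff_natAbs_eq, natAbs_prod]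
  exact Finset.prod_eq_one fun i _ => Int.natAbs_sign_of_ne_zero (hd i)

theorem toQ_mul (n : ℕ) (A B : Matrix (Fin n) (Fin n) ℤ) : toQ n (A * B) = toQ n A * toQ n B :=
  Matrix.map_mul (f := Int.castRingHom ℚ)

theorem toQ_injective (n : ℕ) : Function.Injective (toQ n) :=
  Matrix.map_injective Int.cast_injective

theorem det_toQ (n : ℕ) (A : Matrix (Fin n) (Fin n) ℤ) : (toQ n A).det = (A.det : ℚ) :=
  ((Int.castRingHom ℚ).map_det A).symm

theorem mem_Lambda_iff {n : ℕ} {γ : Matrix (Fin n) (Fin n) ℚ} :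
    γ ∈ Lambda n ↔ ∃ V, IsUnit V ∧ γ = toQ n V := by
  have hdet : ∀ V : Matrix (Fin n) (Fin n) ℤ,
      IsUnit V ↔ (toQ n V).det = 1 ∨ (toQ n V).det = -1 := fun V => by
    rw [Matrix.isUnit_iff_isUnit_det, Int.isUnit_iff, det_toQ]
    norm_cast
  constructor
  · rintro ⟨hγ, h⟩
    choose V hV using hγ
    have hγ : γ = toQ n (Matrix.of V) := Matrix.ext hV
    exact ⟨Matrix.of V, (hdet _).2 (hγ ▸ h), hγ⟩
  · rintro ⟨V, hV, rfl⟩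
    exact ⟨fun i j => ⟨V i j, rfl⟩, (hdet V).1 hV⟩

/-- The rational matrices `c * C` where the rows of the integer matrix `C` span `L`. -/
def scaledBases (n : ℕ) (c : ℚ) (L : AddSubgroup (Fin n → ℤ)) :
    Set (Matrix (Fin n) (Fin n) ℚ) :=
  {m | ∃ C, rowLattice C = L ∧ m = c • toQ n C}

theorem scaledBases_rowLattice {n : ℕ} (c : ℚ) {C : Matrix (Fin n) (Fin n) ℤ} (hC : C.det ≠ 0) :
    scaledBases n c (rowLattice C) = rightCoset n (c • toQ n C) := by
  ext m
  constructor
  · rintro ⟨A, hA, rfl⟩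
    obtain ⟨V, hV, rfl⟩ := exists_isUnit_of_rowLattice_eq hC hA
    exact ⟨toQ n V, mem_Lambda_iff.2 ⟨V, hV, rfl⟩, by rw [toQ_mul, Matrix.mul_smul]⟩
  · rintro ⟨γ, hγ, rfl⟩
    obtain ⟨V, hV, rfl⟩ := mem_Lambda_iff.1 hγ
    exact ⟨V * C, rowLattice_mul_of_isUnit V C hV, by rw [toQ_mul, Matrix.mul_smul]⟩

theorem eq_of_scaledBases_rowLattice_eq {n : ℕ} {c : ℚ} (hc : c ≠ 0)
    {A B : Matrix (Fin n) (Fin n) ℤ}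
    (h : scaledBases n c (rowLattice A) = scaledBases n c (rowLattice B)) :
    rowLattice A = rowLattice B := by
  obtain ⟨C, hC, hAC⟩ := h.subset ⟨A, rfl, rfl⟩
  rw [toQ_injective n (smul_right_injective _ hc hAC), hC]

theorem diagonal_eq_smul_toQ_Dmat (n p : ℕ) :
    (Matrix.diagonal fun i : Fin n =>
      if i.val = 0 then (p : ℚ) else if i.val = n - 1 then (p : ℚ) ^ 3 else (p : ℚ) ^ 2) =
      (p : ℚ) • toQ n (Dmat n p) := by
  rw [toQ, Dmat, Matrix.diagonal_map Int.cast_zero, ← Matrix.diagonal_smul]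
  congr 1
  ext i
  simp only [Pi.smul_apply, smul_eq_mul]
  split_ifs <;> push_cast <;> ring

theorem rightCosets_eq_image {n p : ℕ} (hn : 2 ≤ n) (hp : p.Prime) :
    {S | ∃ h ∈ doubleCoset n ((p : ℚ) • toQ n (Dmat n p)), S = rightCoset n h} =
      scaledBases n p '' neighborLattices p n := by
  ext S
  constructor
  · rintro ⟨_, ⟨γ₁, h₁, γ₂, h₂, rfl⟩, rfl⟩
    obtain ⟨V, hV, rfl⟩ := mem_Lambda_iff.1 h₁
    obtain ⟨U, hU, rfl⟩ := mem_Lambda_iff.1 h₂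
    refine ⟨_, rowLattice_Dmat_mul_mem hn hp hU, ?_⟩
    rw [← rowLattice_mul_of_isUnit V _ hV, scaledBases_rowLattice, toQ_mul, toQ_mul,
      Matrix.mul_smul, Matrix.smul_mul, mul_assoc]
    rw [Matrix.det_mul]
    exact mul_ne_zero ((Matrix.isUnit_iff_isUnit_det V).1 hV).ne_zero
      (det_Dmat_mul_ne_zero hn hp.ne_zero hU)
  · rintro ⟨L, hL, rfl⟩
    obtain ⟨U, hU, rfl⟩ := exists_eq_rowLattice_Dmat_mul hn hp hL
    refine ⟨_, ⟨1, mem_Lambda_iff.2 ⟨1, isUnit_one, ?_⟩, toQ n U,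
      mem_Lambda_iff.2 ⟨U, hU, rfl⟩, rfl⟩, ?_⟩
    · exact (Matrix.map_one _ Int.cast_zero Int.cast_one).symm
    · rw [scaledBases_rowLattice _ (det_Dmat_mul_ne_zero hn hp.ne_zero hU), toQ_mul, one_mul,
        Matrix.smul_mul]

theorem degree_smul_toQ_Dmat {n p : ℕ} (hn : 2 ≤ n) (hp : p.Prime) :
    degree n ((p : ℚ) • toQ n (Dmat n p)) =
      (∑ i ∈ Finset.range n, p ^ i) * (∑ i ∈ Finset.range n, p ^ i - 1) := by
  have : Fact p.Prime := ⟨hp⟩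
  rw [degree, rightCosets_eq_image hn hp, Set.InjOn.ncard_image,
    card_neighborLattices p n (by omega)]
  intro L hL L' hL' h
  obtain ⟨U, -, rfl⟩ := exists_eq_rowLattice_Dmat_mul hn hp hL
  obtain ⟨U', -, rfl⟩ := exists_eq_rowLattice_Dmat_mul hn hp hL'
  exact eq_of_scaledBases_rowLattice_eq (by exact_mod_cast hp.ne_zero) h

theorem statement4 (n p : ℕ) (hn : 4 ≤ n) (hp : p.Prime) :
    (degree n (Matrix.diagonal fun i : Fin n =>
      if i.val = 0 then (p : ℚ) else if i.val = n - 1 then (p : ℚ) ^ 3 else (p : ℚ) ^ 2) : ℚ) =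
      (p : ℚ) * ((p : ℚ) ^ (n - 1) - 1) * ((p : ℚ) ^ n - 1) / ((p : ℚ) - 1) ^ 2 := by
  have hp1 : (p : ℚ) ≠ 1 := by exact_mod_cast hp.ne_one
  have hsub : (p : ℚ) - 1 ≠ 0 := sub_ne_zero.2 hp1
  obtain ⟨m, rfl⟩ : ∃ m, n = m + 1 := ⟨n - 1, by omega⟩
  have hG : ∑ i ∈ Finset.range (m + 1), p ^ i - 1 = (∑ i ∈ Finset.range m, p ^ i) * p := by
    rw [Finset.sum_range_succ', pow_zero, Nat.add_sub_cancel, Finset.sum_mul]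
    rfl
  rw [diagonal_eq_smul_toQ_Dmat, degree_smul_toQ_Dmat (by omega) hp, hG, Nat.add_sub_cancel]
  push_cast
  rw [geom_sum_eq hp1, geom_sum_eq hp1]
  field_simp
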